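/- For every integer a ≥ 1, the operator S_a on L²((0,1),ℂ) defined by S_a[f](x) = f(x) − 4a x^{2a−1} ∫_x^1 f(t) t^{−2a} dt is a bounded linear operator; its Hilbert-space adjoint is given by S_a^*[g](x) = g(x) − (4a/x^{2a}) ∫₀^x t^{2a−1} g(t) dt; and the family pairwise commutes: S_a S_b = S_b S_a for all integers a, b ≥ 1. -/

import Mathlib

open MeasureTheory Complex Filter intervalIntegral

noncomputable section

/-- Riccati–Bessel function `j_a`. -/
def jb : ℕ → ℂ → ℂ
  | 0 => Complex.sin
  | a + 1 => fun z => (((a : ℕ) + 1 : ℂ)) / z * jb a z - deriv (jb a) z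

/-- Riccati–Bessel function `η_a`. -/
def yb : ℕ → ℂ → ℂ
  | 0 => Complex.cos
  | a + 1 => fun z => (((a : ℕ) + 1 : ℂ)) / z * yb a z - deriv (yb a) z

/-- The double factorial `(2a+1)!!`. -/
def dfact (a : ℕ) : ℕ := ∏ i ∈ Finset.range (a + 1), (2 * i + 1)

/-- A square root of a complex number. -/
def sqrtC (lam : ℂ) : ℂ := lam ^ (1/2 : ℂ)

/-- The regular solution `u(x,λ)` of the free singular equation. -/
def uSol (a : ℕ) (x : ℝ) (lam : ℂ) : ℂ :=
  (dfact a : ℂ) / sqrtC lam ^ (a + 1) * jb a (sqrtC lam * x)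

/-- The singular solution `v(x,λ)` of the free singular equation. -/
def vSol (a : ℕ) (x : ℝ) (lam : ℂ) : ℂ :=
  -(sqrtC lam ^ a / (dfact a : ℂ)) * yb a (sqrtC lam * x)

/-- The Green function `G(x,t,λ)`. -/
def green (a : ℕ) (x t : ℝ) (lam : ℂ) : ℂ :=
  vSol a x lam * uSol a t lam - uSol a x lam * vSol a t lam

/-- The Picard iterates `φ_k`. -/
def phiIter (a : ℕ) (q : ℝ → ℂ) : ℕ → ℝ → ℂ → ℂ
  | 0 => fun x lam => uSol a x lam
  | k + 1 => fun x lam => ∫ t in (0:ℝ)..x, green a x t lam * q t * phiIter a q k t lam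

/-- The regular solution `φ(x,λ,q)`. -/
def phiSol (a : ℕ) (q : ℝ → ℂ) (x : ℝ) (lam : ℂ) : ℂ := ∑' k, phiIter a q k x lam

/-- The Picard iterates `ψ̃_k`. -/
def psiIter (a : ℕ) (q : ℝ → ℂ) : ℕ → ℝ → ℂ → ℂ
  | 0 => fun x lam => vSol a x lam
  | k + 1 => fun x lam => -∫ t in x..(1:ℝ), green a x t lam * q t * psiIter a q k t lam

/-- The singular solution `ψ̃(x,λ,q)`. -/
def psiSol (a : ℕ) (q : ℝ → ℂ) (x : ℝ) (lam : ℂ) : ℂ := ∑' k, psiIter a q k x lam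

/-- Lebesgue measure restricted to `(0,1)`. -/
def mu01 : Measure ℝ := volume.restrict (Set.Ioo 0 1)

open scoped ENNReal NNReal

theorem sq_lintegral_mul_le_weighted {α : Type*} [MeasurableSpace α] {μ : Measure α}
    {κ v F : α → ℝ≥0∞} (hκ : Measurable κ) (hv : Measurable v) (hF : Measurable F)
    (hv0 : ∀ᵐ t ∂μ, v t ≠ 0 ∧ v t ≠ ∞) :
    (∫⁻ t, κ t * F t ∂μ) ^ 2 ≤
      (∫⁻ t, κ t * v t ^ 2 ∂μ) * ∫⁻ t, κ t * (F t / v t) ^ 2 ∂μ := by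
  have hsq : ∀ y : ℝ≥0∞, (y ^ (1 / 2 : ℝ)) ^ 2 = y := fun y => by
    rw [← ENNReal.rpow_natCast, ← ENNReal.rpow_mul]; norm_num
  have h := ENNReal.lintegral_mul_le_Lp_mul_Lq μ Real.HolderConjugate.two_two
    (f := fun t => κ t ^ (1 / 2 : ℝ) * v t) (g := fun t => κ t ^ (1 / 2 : ℝ) * (F t / v t))
    ((hκ.pow_const _).mul hv).aemeasurable ((hκ.pow_const _).mul (hF.div hv)).aemeasurable
  simp only [Pi.mul_apply, ENNReal.rpow_two, mul_pow, hsq] at h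
  have h' := pow_le_pow_left₀ zero_le h 2
  rw [mul_pow, hsq, hsq] at h'
  refine le_of_eq_of_le ?_ h'
  congr 1
  refine lintegral_congr_ae ?_
  filter_upwards [hv0] with t ht
  calc κ t * F t = (κ t ^ (1 / 2 : ℝ)) ^ 2 * (v t * (F t / v t)) := by
        rw [hsq, ENNReal.mul_div_cancel ht.1 ht.2]
    _ = _ := by ring

/-- A real kernel satisfying the two weighted Schur bounds. -/
structure IsSchurKernel {α : Type*} [MeasurableSpace α] (μ : Measure α) (k : α → α → ℝ)
    (v : α → ℝ≥0∞) (C : ℝ≥0) : Prop where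
  measurable : Measurable (Function.uncurry k)
  measurable_weight : Measurable v
  weight : ∀ᵐ t ∂μ, v t ≠ 0 ∧ v t ≠ ∞
  left : ∀ᵐ x ∂μ, ∫⁻ t, ‖k x t‖ₑ * v t ^ 2 ∂μ ≤ C * v x ^ 2
  right : ∀ᵐ t ∂μ, ∫⁻ x, ‖k x t‖ₑ * v x ^ 2 ∂μ ≤ C * v t ^ 2

namespace IsSchurKernel

variable {α : Type*} [MeasurableSpace α] {μ : Measure α} {k : α → α → ℝ}
    {v : α → ℝ≥0∞} {C : ℝ≥0}

theorem swap (h : IsSchurKernel μ k v C) : IsSchurKernel μ (fun x t => k t x) v C :=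
  ⟨h.measurable.comp measurable_swap, h.measurable_weight, h.weight, h.right, h.left⟩

theorem measurable_left (h : IsSchurKernel μ k v C) (x : α) : Measurable (k x) :=
  h.measurable.comp measurable_prodMk_left

theorem measurable_enorm_mul (h : IsSchurKernel μ k v C) {F : α → ℝ≥0∞} (hF : Measurable F) :
    Measurable (Function.uncurry fun x t => ‖k x t‖ₑ * F t) :=
  h.measurable.enorm.mul (hF.comp measurable_snd)

theorem lintegral_sq_le [SFinite μ] (h : IsSchurKernel μ k v C) {F : α → ℝ≥0∞}
    (hF : Measurable F) :
    ∫⁻ x, (∫⁻ t, ‖k x t‖ₑ * F t ∂μ) ^ 2 ∂μ ≤ (C : ℝ≥0∞) ^ 2 * ∫⁻ t, F t ^ 2 ∂μ := by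
  have hv := h.measurable_weight
  have hG : Measurable fun t => (F t / v t) ^ 2 := (hF.div hv).pow_const 2
  calc ∫⁻ x, (∫⁻ t, ‖k x t‖ₑ * F t ∂μ) ^ 2 ∂μ
      ≤ ∫⁻ x, C * v x ^ 2 * ∫⁻ t, ‖k x t‖ₑ * (F t / v t) ^ 2 ∂μ ∂μ := by
        refine lintegral_mono_ae ?_
        filter_upwards [h.left] with x hx
        exact (sq_lintegral_mul_le_weighted (h.measurable_left x).enorm hv hF h.weight).trans
          (mul_le_mul_left hx _)
    _ = ∫⁻ x, ∫⁻ t, C * v x ^ 2 * (‖k x t‖ₑ * (F t / v t) ^ 2) ∂μ ∂μ := by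
        refine lintegral_congr fun x => (lintegral_const_mul _ ?_).symm
        exact (h.measurable_left x).enorm.mul hG
    _ = ∫⁻ t, ∫⁻ x, C * v x ^ 2 * (‖k x t‖ₑ * (F t / v t) ^ 2) ∂μ ∂μ := by
        refine lintegral_lintegral_swap (Measurable.aemeasurable ?_)
        exact (((hv.pow_const 2).const_mul _).comp measurable_fst).mul (h.measurable_enorm_mul hG)
    _ = ∫⁻ t, C * (F t / v t) ^ 2 * ∫⁻ x, ‖k x t‖ₑ * v x ^ 2 ∂μ ∂μ := by
        refine lintegral_congr fun t => ?_
        rw [← lintegral_const_mul _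
          (show Measurable fun x => ‖k x t‖ₑ * v x ^ 2 from
            (h.swap.measurable_left t).enorm.mul (hv.pow_const 2))]
        exact lintegral_congr fun x => by ring
    _ ≤ ∫⁻ t, (C : ℝ≥0∞) ^ 2 * F t ^ 2 ∂μ := by
        refine lintegral_mono_ae ?_
        filter_upwards [h.right, h.weight] with t ht ht0
        calc C * (F t / v t) ^ 2 * ∫⁻ x, ‖k x t‖ₑ * v x ^ 2 ∂μ
            ≤ C * (F t / v t) ^ 2 * (C * v t ^ 2) := mul_le_mul_right ht _
          _ = (C : ℝ≥0∞) ^ 2 * (v t * (F t / v t)) ^ 2 := by ring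
          _ = _ := by rw [ENNReal.mul_div_cancel ht0.1 ht0.2]
    _ = _ := lintegral_const_mul _ (hF.pow_const 2)

theorem eLpNorm_two_sq {E : Type*} [NormedAddCommGroup E] (f : α → E) :
    eLpNorm f 2 μ ^ 2 = ∫⁻ x, ‖f x‖ₑ ^ 2 ∂μ := by
  simpa using eLpNorm_nnreal_pow_eq_lintegral (f := f) (μ := μ) (p := 2) two_ne_zero

theorem lintegral_sq_lt_top (f : Lp ℂ 2 μ) : ∫⁻ t, ‖f t‖ₑ ^ 2 ∂μ < ∞ := by
  rw [← eLpNorm_two_sq]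
  exact ENNReal.pow_lt_top (Lp.memLp f).2

theorem integrable [SFinite μ] (h : IsSchurKernel μ k v C) (f : Lp ℂ 2 μ) :
    ∀ᵐ x ∂μ, Integrable (fun t => (k x t : ℂ) * f t) μ := by
  have hf := Lp.stronglyMeasurable f
  have hlt := (h.lintegral_sq_le hf.measurable.enorm).trans_lt
    (ENNReal.mul_lt_top (by simp) (lintegral_sq_lt_top f))
  have hm : Measurable fun x => (∫⁻ t, ‖k x t‖ₑ * ‖f t‖ₑ ∂μ) ^ 2 :=
    ((h.measurable_enorm_mul hf.measurable.enorm).lintegral_prod_right').pow_const 2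
  filter_upwards [ae_lt_top hm hlt.ne] with x hx
  refine ⟨((measurable_ofReal.comp (h.measurable_left x)).mul hf.measurable).aestronglyMeasurable,
    ?_⟩
  simp only [HasFiniteIntegral, enorm_mul]
  have : ∀ r : ℝ, ‖(r : ℂ)‖ₑ = ‖r‖ₑ := fun r => by simp [enorm_eq_nnnorm]
  simp only [this]
  exact (ENNReal.pow_lt_top_iff.1 hx).resolve_right two_ne_zero

theorem eLpNorm_integral_le [SFinite μ] (h : IsSchurKernel μ k v C) (f : Lp ℂ 2 μ) :
    eLpNorm (fun x => ∫ t, (k x t : ℂ) * f t ∂μ) 2 μ ≤ C * eLpNorm f 2 μ := by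
  have hf := Lp.stronglyMeasurable f
  refine (ENNReal.pow_le_pow_left_iff two_ne_zero).1 ?_
  rw [mul_pow, eLpNorm_two_sq, eLpNorm_two_sq]
  refine le_trans (lintegral_mono fun x => ?_) (h.lintegral_sq_le hf.measurable.enorm)
  refine pow_le_pow_left₀ zero_le ((enorm_integral_le_lintegral_enorm _).trans_eq ?_) 2
  exact lintegral_congr fun t => by simp [enorm_eq_nnnorm]

theorem memLp [SFinite μ] (h : IsSchurKernel μ k v C) (f : Lp ℂ 2 μ) :
    MemLp (fun x => ∫ t, (k x t : ℂ) * f t ∂μ) 2 μ := by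
  refine ⟨?_, (h.eLpNorm_integral_le f).trans_lt (ENNReal.mul_lt_top (by simp) (Lp.memLp f).2)⟩
  have : StronglyMeasurable fun p : α × α => (k p.1 p.2 : ℂ) * f p.2 :=
    ((measurable_ofReal.comp h.measurable).mul
      ((Lp.stronglyMeasurable f).measurable.comp measurable_snd)).stronglyMeasurable
  exact this.integral_prod_right.aestronglyMeasurable

/-- The bounded operator on `L²` defined by a Schur kernel. -/
def toCLM [SFinite μ] (h : IsSchurKernel μ k v C) : Lp ℂ 2 μ →L[ℂ] Lp ℂ 2 μ :=
  LinearMap.mkContinuous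
    { toFun := fun f => (h.memLp f).toLp _
      map_add' := fun f g => by
        rw [← MemLp.toLp_add]
        refine MemLp.toLp_congr _ _ ?_
        filter_upwards [h.integrable f, h.integrable g] with x hf hg
        rw [Pi.add_apply, ← integral_add hf hg]
        refine integral_congr_ae ?_
        filter_upwards [Lp.coeFn_add f g] with t ht
        rw [ht, Pi.add_apply, mul_add]
      map_smul' := fun c f => by
        rw [RingHom.id_apply, ← MemLp.toLp_const_smul]
        refine MemLp.toLp_congr _ _ (Eventually.of_forall fun x => ?_)
        simp only [Pi.smul_apply]
        rw [← MeasureTheory.integral_smul]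
        refine integral_congr_ae ?_
        filter_upwards [Lp.coeFn_smul c f] with t ht
        simp only [ht, Pi.smul_apply, smul_eq_mul]
        ring }
    C fun f => by
      have hfin : (C : ℝ≥0∞) * eLpNorm f 2 μ ≠ ∞ :=
        (ENNReal.mul_lt_top (by simp) (Lp.memLp f).2).ne
      have := ENNReal.toReal_mono hfin (h.eLpNorm_integral_le f)
      simpa [Lp.norm_def, eLpNorm_congr_ae (h.memLp f).coeFn_toLp] using this

theorem coeFn_toCLM [SFinite μ] (h : IsSchurKernel μ k v C) (f : Lp ℂ 2 μ) :
    h.toCLM f =ᵐ[μ] fun x => ∫ t, (k x t : ℂ) * f t ∂μ :=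
  (h.memLp f).coeFn_toLp

theorem integrable_prod [SFinite μ] (h : IsSchurKernel μ k v C) (f g : Lp ℂ 2 μ) :
    Integrable (fun p : α × α => starRingEnd ℂ (f p.1) * ((k p.1 p.2 : ℂ) * g p.2))
      (μ.prod μ) := by
  have hf := (Lp.stronglyMeasurable f).measurable
  have hg := (Lp.stronglyMeasurable g).measurable
  have hm : Measurable fun p : α × α => starRingEnd ℂ (f p.1) * ((k p.1 p.2 : ℂ) * g p.2) :=
    (continuous_conj.measurable.comp (hf.comp measurable_fst)).mul
      ((measurable_ofReal.comp h.measurable).mul (hg.comp measurable_snd))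
  refine ⟨hm.aestronglyMeasurable, ?_⟩
  rw [HasFiniteIntegral, lintegral_prod _ hm.enorm.aemeasurable]
  have hK := h.measurable_enorm_mul hg.enorm
  calc ∫⁻ x, ∫⁻ t, ‖starRingEnd ℂ (f x) * ((k x t : ℂ) * g t)‖ₑ ∂μ ∂μ
      = ∫⁻ x, ‖f x‖ₑ * ∫⁻ t, ‖k x t‖ₑ * ‖g t‖ₑ ∂μ ∂μ := by
        refine lintegral_congr fun x => ?_
        rw [← lintegral_const_mul _
          (show Measurable fun t => ‖k x t‖ₑ * ‖g t‖ₑ from hK.comp measurable_prodMk_left)]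
        exact lintegral_congr fun t => by simp [enorm_eq_nnnorm]
    _ ≤ ∫⁻ x, (‖f x‖ₑ ^ 2 + (∫⁻ t, ‖k x t‖ₑ * ‖g t‖ₑ ∂μ) ^ 2) ∂μ := by
        refine lintegral_mono fun x => ?_
        rcases le_total ‖f x‖ₑ (∫⁻ t, ‖k x t‖ₑ * ‖g t‖ₑ ∂μ) with hle | hle
        · exact (mul_le_mul_left hle _).trans (by rw [← sq]; exact le_add_self)
        · exact (mul_le_mul_right hle _).trans (by rw [← sq]; exact le_self_add)
    _ < ∞ := by
        rw [lintegral_add_left (hf.enorm.pow_const 2)]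
        exact ENNReal.add_lt_top.2 ⟨lintegral_sq_lt_top f,
          (h.lintegral_sq_le hg.enorm).trans_lt
            (ENNReal.mul_lt_top (by simp) (lintegral_sq_lt_top g))⟩

theorem adjoint_toCLM [SFinite μ] (h : IsSchurKernel μ k v C) :
    ContinuousLinearMap.adjoint h.toCLM = h.swap.toCLM := by
  symm
  rw [ContinuousLinearMap.eq_adjoint_iff]
  intro f g
  have hi := h.swap.integrable_prod g f
  calc inner ℂ (h.swap.toCLM f) g
      = starRingEnd ℂ (∫ x, ∫ t, starRingEnd ℂ (g x) * ((k t x : ℂ) * f t) ∂μ ∂μ) := by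
        rw [L2.inner_def, ← integral_conj]
        refine integral_congr_ae ?_
        filter_upwards [h.swap.coeFn_toCLM f] with x hx
        rw [hx, MeasureTheory.integral_const_mul, RCLike.inner_apply]
        simp
    _ = starRingEnd ℂ (∫ t, ∫ x, starRingEnd ℂ (g x) * ((k t x : ℂ) * f t) ∂μ ∂μ) := by
        rw [integral_integral_swap hi]
    _ = inner ℂ f (h.toCLM g) := by
        rw [L2.inner_def, ← integral_conj]
        refine integral_congr_ae ?_
        filter_upwards [h.coeFn_toCLM g] with t ht
        rw [ht, RCLike.inner_apply, ← integral_conj, ← MeasureTheory.integral_mul_const]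
        refine integral_congr_ae (Eventually.of_forall fun x => ?_)
        simp only [map_mul, conj_conj, conj_ofReal]
        ring

end IsSchurKernel

instance isProbabilityMeasure_mu01 : IsProbabilityMeasure mu01 := ⟨by simp [mu01]⟩

theorem ae_mem_Ioo_mu01 : ∀ᵐ x ∂mu01, x ∈ Set.Ioo (0 : ℝ) 1 :=
  ae_restrict_mem measurableSet_Ioo

/-- The Hardy-type kernel `4a x^{2a−1} t^{−2a}`, supported on `x < t`. -/
def hardyKernel (a : ℕ) (x t : ℝ) : ℝ :=
  if x < t then 4 * a * x ^ (2 * a - 1) / t ^ (2 * a) else 0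

theorem hardyKernel_mul_rpow_left {a : ℕ} (ha : 1 ≤ a) {x t : ℝ} (hx : 0 < x) (hxt : x < t) :
    ‖hardyKernel a x t‖ₑ * ENNReal.ofReal (t ^ (-1 / 4 : ℝ)) ^ 2 =
      ENNReal.ofReal (4 * a * x ^ (2 * a - 1) * t ^ (-(2 * a) - 1 / 2 : ℝ)) := by
  have ht := hx.trans hxt
  rw [hardyKernel, if_pos hxt, Real.enorm_eq_ofReal (by positivity), ← ENNReal.ofReal_pow
    (by positivity), ← ENNReal.ofReal_mul (by positivity)]
  congr 1
  have h1 : (t ^ (-1 / 4 : ℝ)) ^ 2 = t ^ (-1 / 2 : ℝ) := by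
    rw [← Real.rpow_natCast, ← Real.rpow_mul ht.le]; norm_num
  have h2 : t ^ (-(2 * a) - 1 / 2 : ℝ) = t ^ (-1 / 2 : ℝ) / t ^ (2 * a) := by
    rw [← Real.rpow_natCast, ← Real.rpow_sub ht]; congr 1; push_cast; ring
  rw [h1, h2]
  ring

theorem hardyKernel_mul_rpow_right {a : ℕ} (ha : 1 ≤ a) {x t : ℝ} (hx : 0 < x) (hxt : x < t) :
    ‖hardyKernel a x t‖ₑ * ENNReal.ofReal (x ^ (-1 / 4 : ℝ)) ^ 2 =
      ENNReal.ofReal (4 * a / t ^ (2 * a) * x ^ (2 * a - 3 / 2 : ℝ)) := by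
  have ht := hx.trans hxt
  rw [hardyKernel, if_pos hxt, Real.enorm_eq_ofReal (by positivity), ← ENNReal.ofReal_pow
    (by positivity), ← ENNReal.ofReal_mul (by positivity)]
  congr 1
  have h1 : (x ^ (-1 / 4 : ℝ)) ^ 2 = x ^ (-1 / 2 : ℝ) := by
    rw [← Real.rpow_natCast, ← Real.rpow_mul hx.le]; norm_num
  have h2 : x ^ (2 * a - 3 / 2 : ℝ) = x ^ (2 * a - 1) * x ^ (-1 / 2 : ℝ) := by
    rw [← Real.rpow_natCast, ← Real.rpow_add hx]; congr 1
    rw [Nat.cast_sub (by omega)]; push_cast; ring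
  rw [h1, h2]
  ring

theorem ofReal_le_four_mul_rpow {x r : ℝ} (hx : 0 < x) (h : r ≤ 4 * x ^ (-1 / 2 : ℝ)) :
    ENNReal.ofReal r ≤ ((4 : ℝ≥0) : ℝ≥0∞) * ENNReal.ofReal (x ^ (-1 / 4 : ℝ)) ^ 2 := by
  have h1 : (x ^ (-1 / 4 : ℝ)) ^ 2 = x ^ (-1 / 2 : ℝ) := by
    rw [← Real.rpow_natCast, ← Real.rpow_mul hx.le]; norm_num
  rw [← ENNReal.ofReal_pow (by positivity), h1, ← ENNReal.ofReal_coe_nnreal,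
    ← ENNReal.ofReal_mul (by simp)]
  exact ENNReal.ofReal_le_ofReal (by simpa using h)

theorem isSchurKernel_hardyKernel {a : ℕ} (ha : 1 ≤ a) :
    IsSchurKernel mu01 (hardyKernel a) (fun t => ENNReal.ofReal (t ^ (-1 / 4 : ℝ))) 4 where
  measurable := by
    unfold hardyKernel
    exact Measurable.ite (measurableSet_lt measurable_fst measurable_snd)
      (by fun_prop) measurable_const
  measurable_weight := by fun_prop
  weight := by
    filter_upwards [ae_mem_Ioo_mu01] with t ht
    have : 0 < t ^ (-1 / 4 : ℝ) := Real.rpow_pos_of_pos ht.1 _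
    simp [this]
  left := by
    have ha' : (1 : ℝ) ≤ a := by exact_mod_cast ha
    filter_upwards [ae_mem_Ioo_mu01] with x ⟨hx, _⟩
    have hexp : (-(2 * a) - 1 / 2 : ℝ) < -1 := by linarith
    calc _ ≤ ∫⁻ t in Set.Ioi x,
          ENNReal.ofReal (4 * a * x ^ (2 * a - 1) * t ^ (-(2 * a) - 1 / 2 : ℝ)) := by
          rw [← lintegral_indicator measurableSet_Ioi]
          refine lintegral_mono' Measure.restrict_le_self fun t => ?_
          by_cases hxt : x < t
          · rw [Set.indicator_of_mem (Set.mem_Ioi.2 hxt), hardyKernel_mul_rpow_left ha hx hxt]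
          · simp [hardyKernel, hxt]
      _ = ENNReal.ofReal (∫ t in Set.Ioi x,
          4 * a * x ^ (2 * a - 1) * t ^ (-(2 * a) - 1 / 2 : ℝ)) := by
          refine (ofReal_integral_eq_lintegral_ofReal
            ((integrableOn_Ioi_rpow_of_lt hexp hx).const_mul _) ?_).symm
          filter_upwards [ae_restrict_mem measurableSet_Ioi] with t ht
          have : 0 < t := hx.trans ht
          positivity
      _ ≤ _ := by
          refine ofReal_le_four_mul_rpow hx ?_
          rw [MeasureTheory.integral_const_mul, integral_Ioi_rpow_of_lt hexp hx]
          have h2 : x ^ (-(2 * a) - 1 / 2 + 1 : ℝ) * x ^ (2 * a - 1) = x ^ (-1 / 2 : ℝ) := by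
            rw [← Real.rpow_natCast, ← Real.rpow_add hx]; congr 1
            rw [Nat.cast_sub (by omega)]; push_cast; ring
          calc _ = 4 * a / (2 * a - 1 / 2) *
                (x ^ (-(2 * a) - 1 / 2 + 1 : ℝ) * x ^ (2 * a - 1)) := by
                have h3 : (-(2 * a) - 1 / 2 + 1 : ℝ) = -(2 * a - 1 / 2) := by ring
                rw [h3, div_neg, neg_div, neg_neg]; ring
            _ ≤ _ := by
                rw [h2]
                gcongr
                rw [div_le_iff₀ (by linarith)]
                linarith
  right := by
    have ha' : (1 : ℝ) ≤ a := by exact_mod_cast ha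
    filter_upwards [ae_mem_Ioo_mu01] with t ⟨ht, _⟩
    have hexp : (-1 : ℝ) < 2 * a - 3 / 2 := by linarith
    calc _ ≤ ∫⁻ x in Set.Ioc 0 t,
          ENNReal.ofReal (4 * a / t ^ (2 * a) * x ^ (2 * a - 3 / 2 : ℝ)) := by
          rw [← lintegral_indicator measurableSet_Ioc, mu01,
            ← lintegral_indicator measurableSet_Ioo]
          refine lintegral_mono fun x => ?_
          by_cases hxt : x ∈ Set.Ioo 0 1 ∧ x < t
          · rw [Set.indicator_of_mem hxt.1, Set.indicator_of_mem
              (show x ∈ Set.Ioc 0 t from ⟨hxt.1.1, hxt.2.le⟩),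
              hardyKernel_mul_rpow_right ha hxt.1.1 hxt.2]
          · rw [not_and'] at hxt
            by_cases hlt : x < t
            · simp [Set.indicator_of_notMem (hxt hlt)]
            · simp [Set.indicator, hardyKernel, hlt]
      _ = ENNReal.ofReal (∫ x in Set.Ioc 0 t,
          4 * a / t ^ (2 * a) * x ^ (2 * a - 3 / 2 : ℝ)) := by
          refine (ofReal_integral_eq_lintegral_ofReal
            ((intervalIntegrable_iff_integrableOn_Ioc_of_le ht.le).1
              ((intervalIntegrable_rpow' hexp).const_mul _)) ?_).symm
          filter_upwards [ae_restrict_mem measurableSet_Ioc] with x hx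
          have : 0 < x := hx.1
          positivity
      _ ≤ _ := by
          refine ofReal_le_four_mul_rpow ht ?_
          rw [← intervalIntegral.integral_of_le ht.le, intervalIntegral.integral_const_mul,
            integral_rpow (Or.inl hexp), Real.zero_rpow (by linarith), sub_zero]
          have h2 : t ^ (2 * a - 3 / 2 + 1 : ℝ) / t ^ (2 * a) = t ^ (-1 / 2 : ℝ) := by
            rw [← Real.rpow_natCast, ← Real.rpow_sub ht]; congr 1
            push_cast; ring
          calc _ = 4 * a / (2 * a - 3 / 2 + 1) *
                (t ^ (2 * a - 3 / 2 + 1 : ℝ) / t ^ (2 * a)) := by ring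
            _ ≤ _ := by
                rw [h2]
                gcongr
                rw [div_le_iff₀ (by linarith)]
                linarith

theorem integral_hardyKernel_mul (a : ℕ) (f : ℝ → ℂ) {x : ℝ} (hx : x ∈ Set.Ioo (0 : ℝ) 1) :
    ∫ t, (hardyKernel a x t : ℂ) * f t ∂mu01 =
      ((4 * a * x ^ (2 * a - 1) : ℝ) : ℂ) * ∫ t in x..(1 : ℝ), f t / (t : ℂ) ^ (2 * a) := by
  rw [intervalIntegral.integral_of_le hx.2.le, integral_Ioc_eq_integral_Ioo,
    ← MeasureTheory.integral_const_mul, mu01, ← MeasureTheory.integral_indicator measurableSet_Ioo,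
    ← MeasureTheory.integral_indicator measurableSet_Ioo]
  refine integral_congr_ae (Eventually.of_forall fun t => ?_)
  by_cases hxt : x < t
  · by_cases ht : t < 1
    · simp only [Set.indicator, Set.mem_Ioo, hxt, ht, hx.1.trans hxt, and_self, if_true,
        hardyKernel]
      push_cast
      ring
    · simp [Set.indicator, ht]
  · simp [Set.indicator, hardyKernel, hxt]

theorem integral_hardyKernel_swap_mul (a : ℕ) (g : ℝ → ℂ) {x : ℝ}
    (hx : x ∈ Set.Ioo (0 : ℝ) 1) :
    ∫ t, (hardyKernel a t x : ℂ) * g t ∂mu01 =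
      ((4 * a : ℝ) : ℂ) / (x : ℂ) ^ (2 * a) *
        ∫ t in (0 : ℝ)..x, (t : ℂ) ^ (2 * a - 1) * g t := by
  rw [intervalIntegral.integral_of_le hx.1.le, integral_Ioc_eq_integral_Ioo,
    ← MeasureTheory.integral_const_mul, mu01, ← MeasureTheory.integral_indicator measurableSet_Ioo,
    ← MeasureTheory.integral_indicator measurableSet_Ioo]
  refine integral_congr_ae (Eventually.of_forall fun t => ?_)
  by_cases hxt : t < x
  · by_cases ht : 0 < t
    · simp only [Set.indicator, Set.mem_Ioo, hxt, ht, hxt.trans hx.2, and_self, if_true,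
        hardyKernel]
      push_cast
      ring
    · simp [Set.indicator, ht]
  · simp [Set.indicator, hardyKernel, hxt]

theorem memLp_monomial_mu01 (n : ℕ) : MemLp (fun x : ℝ => (x : ℂ) ^ n) 2 mu01 := by
  refine MemLp.of_bound (by fun_prop) 1 ?_
  filter_upwards [ae_mem_Ioo_mu01] with x hx
  rw [norm_pow, norm_real, Real.norm_of_nonneg hx.1.le]
  exact pow_le_one₀ hx.1.le hx.2.le

/-- The monomial `x ^ n` as an element of `L²(0,1)`. -/
def monomialLp (n : ℕ) : Lp ℂ 2 mu01 := (memLp_monomial_mu01 n).toLp _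

theorem coeFn_monomialLp (n : ℕ) : monomialLp n =ᵐ[mu01] fun x => (x : ℂ) ^ n :=
  (memLp_monomial_mu01 n).coeFn_toLp

theorem exists_mem_span_monomialLp (P : Polynomial ℂ) :
    ∃ u ∈ Submodule.span ℂ (Set.range monomialLp), u =ᵐ[mu01] fun x => P.eval (x : ℂ) := by
  induction P using Polynomial.induction_on' with
  | add p q hp hq =>
    obtain ⟨u, hu, hpu⟩ := hp
    obtain ⟨w, hw, hqw⟩ := hq
    refine ⟨u + w, add_mem hu hw, ?_⟩
    filter_upwards [Lp.coeFn_add u w, hpu, hqw] with x h h1 h2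
    rw [h, Pi.add_apply, h1, h2, Polynomial.eval_add]
  | monomial n c =>
    refine ⟨c • monomialLp n, Submodule.smul_mem _ _ (Submodule.subset_span ⟨n, rfl⟩), ?_⟩
    filter_upwards [Lp.coeFn_smul c (monomialLp n), coeFn_monomialLp n] with x h h1
    rw [h, Pi.smul_apply, h1, Polynomial.eval_monomial, smul_eq_mul]

theorem exists_complex_polynomial_near {g : ℝ → ℂ} (hg : Continuous g) {ε : ℝ} (hε : 0 < ε) :
    ∃ P : Polynomial ℂ, ∀ x ∈ Set.Icc (0 : ℝ) 1, ‖g x - P.eval (x : ℂ)‖ ≤ 2 * ε := by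
  obtain ⟨p, hp⟩ := exists_polynomial_near_of_continuousOn 0 1 (fun x => (g x).re)
    (by fun_prop) ε hε
  obtain ⟨q, hq⟩ := exists_polynomial_near_of_continuousOn 0 1 (fun x => (g x).im)
    (by fun_prop) ε hε
  refine ⟨p.map ofRealHom + Polynomial.C I * q.map ofRealHom, fun x hx => ?_⟩
  have hev : ∀ r : Polynomial ℝ, (r.map ofRealHom).eval (x : ℂ) = ((r.eval x : ℝ) : ℂ) := fun r =>
    Polynomial.eval_map_apply ofRealHom x
  rw [Polynomial.eval_add, Polynomial.eval_mul, Polynomial.eval_C, hev, hev]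
  refine (norm_le_abs_re_add_abs_im _).trans ?_
  have h1 := hp x hx
  have h2 := hq x hx
  rw [abs_sub_comm] at h1 h2
  simp only [sub_re, add_re, ofReal_re, mul_re, I_re, zero_mul, I_im, ofReal_im, mul_zero,
    sub_im, add_im, mul_im, one_mul, zero_add, sub_zero, add_zero]
  linarith

theorem dense_span_monomialLp :
    Dense (Submodule.span ℂ (Set.range monomialLp) : Set (Lp ℂ 2 mu01)) := by
  intro f
  rw [EMetric.mem_closure_iff]
  intro ε hε
  obtain ⟨δ, hδ, hδε⟩ := ENNReal.lt_iff_exists_nnreal_btwn.1 hε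
  have hδ' : 0 < (δ : ℝ) := by exact_mod_cast hδ
  obtain ⟨g, hfg, hg⟩ := (Lp.memLp f).exists_boundedContinuous_eLpNorm_sub_le (by simp)
    (ε := ENNReal.ofReal (δ / 3)) (by simpa using hδ')
  obtain ⟨P, hP⟩ := exists_complex_polynomial_near g.continuous (ε := δ / 3) (by positivity)
  obtain ⟨u, hu, huP⟩ := exists_mem_span_monomialLp P
  refine ⟨u, hu, lt_of_le_of_lt ?_ hδε⟩
  have hgu : eLpNorm (⇑g - ⇑u) 2 mu01 ≤ ENNReal.ofReal (2 * (δ / 3)) := by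
    refine (eLpNorm_le_of_ae_bound (C := 2 * (δ / 3)) ?_).trans_eq (by simp)
    filter_upwards [huP, ae_mem_Ioo_mu01] with x hx hx'
    rw [Pi.sub_apply, hx]
    exact hP x ⟨hx'.1.le, hx'.2.le⟩
  rw [Lp.edist_def, ← sub_add_sub_cancel (⇑f) (⇑g) (⇑u)]
  refine (eLpNorm_add_le ((Lp.aestronglyMeasurable f).sub hg.1)
    (hg.1.sub (Lp.aestronglyMeasurable u)) (by norm_num)).trans ?_
  refine (add_le_add hfg hgu).trans_eq ?_
  rw [← ENNReal.ofReal_add (by positivity) (by positivity), ← ENNReal.ofReal_coe_nnreal]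
  congr 1
  ring

theorem toCLM_swap_hardyKernel_monomialLp {a : ℕ} (ha : 1 ≤ a) (n : ℕ) :
    (isSchurKernel_hardyKernel ha).swap.toCLM (monomialLp n) =
      (4 * a / (2 * a + n) : ℂ) • monomialLp n := by
  refine Lp.ext ?_
  filter_upwards [(isSchurKernel_hardyKernel ha).swap.coeFn_toCLM (monomialLp n),
    Lp.coeFn_smul (4 * a / (2 * a + n) : ℂ) (monomialLp n), coeFn_monomialLp n,
    ae_mem_Ioo_mu01] with x h1 h2 h3 hx
  have hx0 : (x : ℂ) ≠ 0 := ofReal_ne_zero.2 hx.1.ne'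
  have hI : ∫ t, (hardyKernel a t x : ℂ) * monomialLp n t ∂mu01 =
      ∫ t, (hardyKernel a t x : ℂ) * (t : ℂ) ^ n ∂mu01 := by
    refine integral_congr_ae ?_
    filter_upwards [coeFn_monomialLp n] with t ht
    rw [ht]
  rw [h1, h2, Pi.smul_apply, h3, hI, integral_hardyKernel_swap_mul a _ hx]
  have hpow : ∀ t : ℝ, (t : ℂ) ^ (2 * a - 1) * (t : ℂ) ^ n =
      ((t ^ (2 * a - 1 + n) : ℝ) : ℂ) := fun t => by push_cast; ring
  simp only [hpow]
  rw [intervalIntegral.integral_ofReal, integral_pow]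
  have e1 : 2 * a - 1 + n + 1 = 2 * a + n := by omega
  have e2 : ((2 * a - 1 + n : ℕ) : ℝ) + 1 = 2 * a + n := by exact_mod_cast e1
  have hne : (2 * a + n : ℂ) ≠ 0 := by
    have : 2 * a + n ≠ 0 := by omega
    exact_mod_cast this
  rw [e1, e2, zero_pow (by omega), sub_zero, smul_eq_mul]
  push_cast
  rw [pow_add]
  field_simp

/-- The operator `S_a`, extended by zero to `a = 0`. -/
def hardyTransform (a : ℕ) : Lp ℂ 2 mu01 →L[ℂ] Lp ℂ 2 mu01 :=
  if ha : 1 ≤ a then 1 - (isSchurKernel_hardyKernel ha).toCLM else 0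

theorem hardyTransform_eq {a : ℕ} (ha : 1 ≤ a) :
    hardyTransform a = 1 - (isSchurKernel_hardyKernel ha).toCLM :=
  dif_pos ha

theorem adjoint_hardyTransform {a : ℕ} (ha : 1 ≤ a) :
    ContinuousLinearMap.adjoint (hardyTransform a) =
      1 - (isSchurKernel_hardyKernel ha).swap.toCLM := by
  rw [hardyTransform_eq ha, map_sub, IsSchurKernel.adjoint_toCLM]
  congr 1
  exact ContinuousLinearMap.adjoint_id

theorem adjoint_hardyTransform_monomialLp {a : ℕ} (ha : 1 ≤ a) (n : ℕ) :
    ContinuousLinearMap.adjoint (hardyTransform a) (monomialLp n) =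
      (1 - 4 * a / (2 * a + n) : ℂ) • monomialLp n := by
  rw [adjoint_hardyTransform ha, sub_smul, one_smul, ← toCLM_swap_hardyKernel_monomialLp ha]
  rfl

theorem hardyTransform_comp_comm {a b : ℕ} (ha : 1 ≤ a) (hb : 1 ≤ b) :
    (hardyTransform a).comp (hardyTransform b) = (hardyTransform b).comp (hardyTransform a) := by
  apply ContinuousLinearMap.adjoint.injective
  rw [ContinuousLinearMap.adjoint_comp, ContinuousLinearMap.adjoint_comp]
  refine ContinuousLinearMap.ext_on dense_span_monomialLp ?_
  rintro _ ⟨n, rfl⟩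
  simp only [ContinuousLinearMap.comp_apply, adjoint_hardyTransform_monomialLp ha,
    adjoint_hardyTransform_monomialLp hb, map_smul]
  exact smul_comm _ _ _

/-- the operators `S_a f (x) = f(x) − 4a x^{2a−1} ∫_x^1 f(t)/t^{2a} dt` are
bounded on `L²((0,1),ℂ)`, their Hilbert-space adjoints are
`S_a^* g (x) = g(x) − (4a/x^{2a}) ∫₀^x t^{2a−1} g(t) dt`, and they pairwise commute. -/
theorem statement11 :
    ∃ S : ℕ → (Lp ℂ 2 mu01 →L[ℂ] Lp ℂ 2 mu01),
      (∀ a : ℕ, 1 ≤ a → ∀ f : Lp ℂ 2 mu01,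
        (S a f : ℝ → ℂ) =ᵐ[mu01] fun x =>
          f x - ((4 * a * x ^ (2 * a - 1) : ℝ) : ℂ)
                  * ∫ t in x..(1:ℝ), f t / (t : ℂ) ^ (2 * a)) ∧
      (∀ a : ℕ, 1 ≤ a → ∀ g : Lp ℂ 2 mu01,
        (ContinuousLinearMap.adjoint (S a) g : ℝ → ℂ) =ᵐ[mu01] fun x =>
          g x - ((4 * a : ℝ) : ℂ) / (x : ℂ) ^ (2 * a)
                  * ∫ t in (0:ℝ)..x, (t : ℂ) ^ (2 * a - 1) * g t) ∧
      (∀ a b : ℕ, 1 ≤ a → 1 ≤ b → (S a).comp (S b) = (S b).comp (S a)) := by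
  refine ⟨hardyTransform, fun a ha f => ?_, fun a ha g => ?_,
    fun a b ha hb => hardyTransform_comp_comm ha hb⟩
  · rw [hardyTransform_eq ha]
    filter_upwards [Lp.coeFn_sub f ((isSchurKernel_hardyKernel ha).toCLM f),
      (isSchurKernel_hardyKernel ha).coeFn_toCLM f, ae_mem_Ioo_mu01] with x h1 h2 hx
    rw [← integral_hardyKernel_mul a f hx, ← h2]
    exact h1
  · rw [adjoint_hardyTransform ha]
    filter_upwards [Lp.coeFn_sub g ((isSchurKernel_hardyKernel ha).swap.toCLM g),
      (isSchurKernel_hardyKernel ha).swap.coeFn_toCLM g, ae_mem_Ioo_mu01] with x h1 h2 hx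
    rw [← integral_hardyKernel_swap_mul a g hx, ← h2]
    exact h1
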